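/- Let E ⊆ X × Y have VC dimension at most d ≥ 2. Then for every r ≥ 2 there exists a 1/r-regular partition pair P of (X,Y) whose number of parts is bounded by a function of d and r only (independent of |X| and |Y|), namely |P| ≤ C·(d·r³·log r)^{d^{2000·r⁷}} for an absolute constant C. -/

import Mathlib

open Finset

/-- Edge density of `E` between `A` and `B`. -/
noncomputable def dens {X Y : Type*} [Fintype X] [Fintype Y] (E : X → Y → Bool)
    (A : Finset X) (B : Finset Y) : ℝ :=
  (((A ×ˢ B).filter (fun p => E p.1 p.2)).card : ℝ) / ((A.card : ℝ) * (B.card : ℝ))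

/-- `(Xi, Yj)` is `ε`-regular for `E`. -/
def regularPair {X Y : Type*} [Fintype X] [Fintype Y] (E : X → Y → Bool) (ε : ℝ)
    (Xi : Finset X) (Yj : Finset Y) : Prop :=
  ∀ A ⊆ Xi, ∀ B ⊆ Yj, ε * Xi.card ≤ A.card → ε * Yj.card ≤ B.card →
    |dens E A B - dens E Xi Yj| < ε

/-- A family of subsets of `S` shattering only sets of size at most `d` has at most
`(#S + 1) ^ d` members. -/
theorem card_le_succ_card_pow_of_shatters {α : Type*} [DecidableEq α] {𝒜 : Finset (Finset α)}
    {S : Finset α} {d : ℕ} (hS : ∀ A ∈ 𝒜, A ⊆ S)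
    (hd : ∀ I ⊆ S, 𝒜.Shatters I → I.card ≤ d) : 𝒜.card ≤ (S.card + 1) ^ d := by
  have hsub : 𝒜.shatterer ⊆ (range (d + 1)).biUnion fun k => S.powersetCard k := by
    intro I hI
    rw [mem_shatterer] at hI
    obtain ⟨u, hu, hIu⟩ := hI (Subset.refl I)
    have hIS : I ⊆ S := (inter_eq_left.1 hIu).trans (hS u hu)
    simp only [mem_biUnion, mem_range, mem_powersetCard]
    exact ⟨I.card, Nat.lt_succ_of_le (hd I hIS hI), hIS, rfl⟩
  calc 𝒜.card ≤ 𝒜.shatterer.card := card_le_card_shatterer 𝒜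
    _ ≤ ∑ k ∈ range (d + 1), (S.powersetCard k).card := (card_le_card hsub).trans card_biUnion_le
    _ ≤ ∑ k ∈ range (d + 1), S.card ^ k * 1 ^ (d - k) * d.choose k := by
        refine sum_le_sum fun k hk => ?_
        rw [card_powersetCard, one_pow, mul_one]
        exact (Nat.choose_le_pow _ _).trans
          (Nat.le_mul_of_pos_right _ (Nat.choose_pos (Nat.lt_succ_iff.1 (mem_range.1 hk))))
    _ = (S.card + 1) ^ d := (add_pow _ _ _).symm

open scoped Classical in
/-- Greedy hitting sets: if each index in `T` is hit by a proportion at least `δ` of `Y`, then some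
`k` points of `Y` miss at most a proportion `(1 - δ) ^ k` of `T`. -/
theorem exists_card_filter_not_hit_le {ι Y : Type*} [Fintype Y] [Nonempty Y] (T : Finset ι)
    (hit : ι → Y → Prop) {δ : ℝ} (hδ : δ ≤ 1)
    (hT : ∀ p ∈ T, δ * Fintype.card Y ≤ (univ.filter (hit p)).card) (k : ℕ) :
    ∃ S : Finset Y, S.card ≤ k ∧
      ((T.filter fun p => ∀ y ∈ S, ¬ hit p y).card : ℝ) ≤ (1 - δ) ^ k * T.card := by
  induction k with
  | zero => exact ⟨∅, by simp, by simp⟩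
  | succ k ih =>
    obtain ⟨S, hSk, hS⟩ := ih
    set U := T.filter fun p => ∀ y ∈ S, ¬ hit p y with hU
    obtain ⟨y, -, hy⟩ : ∃ y ∈ (univ : Finset Y), δ * U.card ≤ (U.filter fun p => hit p y).card := by
      refine exists_le_of_sum_le univ_nonempty ?_
      have h := sum_card_bipartiteAbove_eq_sum_card_bipartiteBelow hit (s := U) (t := univ)
      simp only [bipartiteAbove, bipartiteBelow] at h
      calc ∑ _y : Y, δ * (U.card : ℝ) = U.card • (δ * Fintype.card Y) := by
            simp; ring
        _ ≤ ∑ p ∈ U, ((univ.filter (hit p)).card : ℝ) :=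
            card_nsmul_le_sum _ _ _ fun p hp => hT p (mem_filter.1 hp).1
        _ = _ := by exact_mod_cast h
    refine ⟨insert y S, (card_insert_le _ _).trans (by omega), ?_⟩
    have heq : (T.filter fun p => ∀ z ∈ insert y S, ¬ hit p z) = U.filter fun p => ¬ hit p y := by
      ext p
      simp only [hU, mem_filter, mem_insert, forall_eq_or_imp]
      tauto
    have hsplit : ((U.filter fun p => hit p y).card : ℝ) + (U.filter fun p => ¬ hit p y).card
        = U.card := by
      exact_mod_cast card_filter_add_card_filter_not (s := U) fun p => hit p y
    rw [heq]
    calc ((U.filter fun p => ¬ hit p y).card : ℝ) ≤ (1 - δ) * U.card := by linarith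
      _ ≤ (1 - δ) * ((1 - δ) ^ k * T.card) := by gcongr
      _ = _ := by ring

open scoped Classical in
/-- A polynomial packing bound: rows of a relation of VC dimension at most `d` which pairwise
differ on a proportion at least `δ` of the columns. -/
theorem card_le_of_pairwise_separated {X Y : Type*} [Fintype Y] [Nonempty Y] (E : X → Y → Bool)
    {d : ℕ} (hd : 1 ≤ d)
    (hVC : ∀ I : Finset Y, (∀ J ⊆ I, ∃ x : X, I.filter (fun y => E x y) = J) → I.card ≤ d)
    {δ : ℝ} (hδ0 : 0 < δ) (hδ1 : δ ≤ 1) (R : Finset X)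
    (hR : ∀ x ∈ R, ∀ x' ∈ R, x ≠ x' →
      δ * Fintype.card Y ≤ (univ.filter fun y => E x y ≠ E x' y).card) :
    (R.card : ℝ) ≤ (4 * d / δ + 2) ^ (2 * d) := by
  rcases R.eq_empty_or_nonempty with rfl | hne
  · simp; positivity
  have hm1 : (1 : ℝ) ≤ R.card := by exact_mod_cast hne.card_pos
  have hm0 : (0 : ℝ) < R.card := by linarith
  have hlog : 0 ≤ Real.log R.card := Real.log_nonneg hm1
  set k := ⌊2 * Real.log R.card / δ⌋₊ + 1 with hk
  obtain ⟨S, hSk, hS⟩ := exists_card_filter_not_hit_le R.offDiag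
    (fun p y => E p.1 y ≠ E p.2 y) hδ1 (fun p hp => by
      rw [mem_offDiag] at hp
      convert hR _ hp.1 _ hp.2.1 hp.2.2) k
  have hkδ : 2 * Real.log R.card < δ * k := by
    have := Nat.lt_floor_add_one (2 * Real.log R.card / δ)
    rw [div_lt_iff₀ hδ0] at this
    rw [hk]; push_cast; linarith
  have hlt : (1 - δ) ^ k * (R.offDiag.card : ℝ) < 1 := by
    have h1 : (R.offDiag.card : ℝ) ≤ Real.exp (2 * Real.log R.card) := by
      rw [two_mul, Real.exp_add, Real.exp_log hm0, offDiag_card]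
      exact_mod_cast Nat.sub_le _ _
    have h2 : (1 - δ) ^ k ≤ Real.exp (-(δ * k)) := by
      calc (1 - δ) ^ k ≤ Real.exp (-δ) ^ k := by
            exact pow_le_pow_left₀ (by linarith) (Real.one_sub_le_exp_neg δ) k
        _ = _ := by rw [← Real.exp_nat_mul]; congr 1; ring
    calc _ ≤ Real.exp (-(δ * k)) * Real.exp (2 * Real.log R.card) := by gcongr
      _ < 1 := by
        rw [← Real.exp_add, Real.exp_lt_one_iff]
        linarith
  have hinj : Set.InjOn (fun x => S.filter fun y => E x y) R := by
    intro x hx x' hx' h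
    by_contra hxx
    have hS' : ((R.offDiag.filter fun p => ∀ y ∈ S, ¬ (E p.1 y ≠ E p.2 y)).card : ℝ) ≤
        (1 - δ) ^ k * R.offDiag.card := by
      convert hS
    have hemp := Nat.cast_lt_one.1 (hS'.trans_lt hlt)
    rw [card_eq_zero, filter_eq_empty_iff] at hemp
    refine hemp (x := (x, x')) (mem_offDiag.2 ⟨hx, hx', hxx⟩) fun y hy => not_not.2 ?_
    have := Finset.ext_iff.1 h y
    simp only [mem_filter, hy, true_and] at this
    exact Bool.eq_iff_iff.2 this
  have hcard : R.card ≤ (S.card + 1) ^ d := by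
    rw [← card_image_of_injOn hinj]
    refine card_le_succ_card_pow_of_shatters (by simp) fun I hIS hI => hVC I fun J hJ => ?_
    obtain ⟨u, hu, huJ⟩ := hI hJ
    obtain ⟨x, -, rfl⟩ := mem_image.1 hu
    refine ⟨x, ?_⟩
    rw [← huJ]
    ext y
    simp only [mem_filter, mem_inter]
    exact ⟨fun h => ⟨h.1, hIS h.1, h.2⟩, fun h => ⟨h.1, h.2.2⟩⟩
  have hd0 : (0 : ℝ) < d := by exact_mod_cast hd
  set s : ℝ := (R.card : ℝ) ^ (1 / (2 * d) : ℝ) with hs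
  have hs1 : 1 ≤ s := Real.one_le_rpow hm1 (by positivity)
  have hsm : s ^ (2 * d) = R.card := by
    rw [hs, ← Real.rpow_natCast, ← Real.rpow_mul hm0.le]
    push_cast
    rw [one_div_mul_cancel (by positivity), Real.rpow_one]
  have hlogs : Real.log R.card ≤ 2 * d * s := by
    have := Real.log_le_rpow_div hm0.le (ε := 1 / (2 * d)) (by positivity)
    rw [← hs] at this
    calc _ ≤ _ := this
      _ = _ := by field_simp
  have hSs : (S.card : ℝ) + 1 ≤ (4 * d / δ + 2) * s := by
    have h1 : (S.card : ℝ) ≤ k := by exact_mod_cast hSk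
    have h2 : (k : ℝ) ≤ 2 * Real.log R.card / δ + 1 := by
      rw [hk]; push_cast
      gcongr
      exact Nat.floor_le (by positivity)
    have h3 : 2 * Real.log R.card / δ ≤ 4 * d / δ * s := by
      calc _ ≤ 2 * (2 * d * s) / δ := by gcongr
        _ = _ := by ring
    linarith
  have hsd : s ^ d ≤ (4 * d / δ + 2) ^ d := by
    have h : s ^ d * s ^ d ≤ (4 * d / δ + 2) ^ d * s ^ d := by
      rw [← pow_add, ← two_mul, hsm, ← mul_pow]
      calc (R.card : ℝ) ≤ (S.card + 1) ^ d := by exact_mod_cast hcard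
        _ ≤ _ := by gcongr
    exact le_of_mul_le_mul_right h (by positivity)
  rw [← hsm, mul_comm 2 d, pow_mul, pow_mul]
  gcongr

/-- The partition of a finite type into the nonempty fibers of `f`. -/
noncomputable def fiberPartition {α β : Type*} [Fintype α] [DecidableEq α] [DecidableEq β]
    (f : α → β) : Finpartition (univ : Finset α) :=
  Finpartition.ofExistsUnique (univ.image fun a => univ.filter fun a' => f a' = f a)
    (fun _ _ => subset_univ _)
    (fun a _ => by
      refine ⟨univ.filter fun a' => f a' = f a, by simp, ?_⟩
      rintro t ⟨ht, hat⟩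
      obtain ⟨b, -, rfl⟩ := mem_image.1 ht
      simp only [mem_filter, mem_univ, true_and] at hat
      rw [hat])
    (fun h => by
      obtain ⟨b, -, hb⟩ := mem_image.1 h
      have : b ∈ univ.filter fun a' => f a' = f b := by simp
      rw [hb] at this
      exact notMem_empty _ this)

theorem card_parts_fiberPartition_le {α β : Type*} [Fintype α] [DecidableEq α] [DecidableEq β]
    {f : α → β} {s : Finset β} (hf : ∀ a, f a ∈ s) : (fiberPartition f).parts.card ≤ s.card := by
  have : (fiberPartition f).parts ⊆ s.image fun b => univ.filter fun a' => f a' = b := by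
    intro t ht
    obtain ⟨a, -, rfl⟩ := mem_image.1 ht
    exact mem_image.2 ⟨f a, hf a, rfl⟩
  exact (card_le_card this).trans card_image_le

theorem eq_of_mem_parts_fiberPartition {α β : Type*} [Fintype α] [DecidableEq α] [DecidableEq β]
    {f : α → β} {t : Finset α} (ht : t ∈ (fiberPartition f).parts) {a b : α} (ha : a ∈ t)
    (hb : b ∈ t) : f a = f b := by
  obtain ⟨c, -, rfl⟩ := mem_image.1 ht
  simp only [mem_filter, mem_univ, true_and] at ha hb
  rw [ha, hb]

/-- If `E` is constant on `A ×ˢ B` up to `t |A| |B|` exceptions, the density of the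
exceptions is at most `t`. -/
theorem dens_or_compl_mem_Icc {X Y : Type*} [Fintype X] [Fintype Y] (E : X → Y → Bool) (b : Bool)
    {A : Finset X} {B : Finset Y} (hA : A.Nonempty) (hB : B.Nonempty) {t : ℝ}
    (h : (((A ×ˢ B).filter fun p => E p.1 p.2 ≠ b).card : ℝ) ≤ t * (A.card * B.card)) :
    0 ≤ (if b then 1 - _root_.dens E A B else _root_.dens E A B) ∧
      (if b then 1 - _root_.dens E A B else _root_.dens E A B) ≤ t := by
  have hA0 : (0 : ℝ) < A.card := by exact_mod_cast hA.card_pos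
  have hB0 : (0 : ℝ) < B.card := by exact_mod_cast hB.card_pos
  have heq : (if b then 1 - _root_.dens E A B else _root_.dens E A B) =
      (((A ×ˢ B).filter fun p => E p.1 p.2 ≠ b).card : ℝ) / (A.card * B.card) := by
    cases b with
    | false => simp [_root_.dens]
    | true =>
      have hsplit : (((A ×ˢ B).filter fun p => E p.1 p.2 = true).card : ℝ)
          + ((A ×ˢ B).filter fun p => ¬ E p.1 p.2 = true).card = A.card * B.card := by
        rw [← Nat.cast_mul, ← card_product]
        exact_mod_cast card_filter_add_card_filter_not (s := A ×ˢ B) fun p => E p.1 p.2 = true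
      simp only [if_true, _root_.dens]
      rw [eq_div_iff (by positivity), sub_mul, div_mul_cancel₀ _ (by positivity)]
      linarith
  rw [heq]
  exact ⟨by positivity, (div_le_iff₀ (by positivity)).2 h⟩

/-- A pair on which `E` is nearly constant is regular. -/
theorem regularPair_of_card_ne_le {X Y : Type*} [Fintype X] [Fintype Y] (E : X → Y → Bool)
    (b : Bool) {A : Finset X} {B : Finset Y} (hA : A.Nonempty) (hB : B.Nonempty) {ε : ℝ}
    (hε0 : 0 < ε) (hε1 : ε ≤ 1)
    (h : (((A ×ˢ B).filter fun p => E p.1 p.2 ≠ b).card : ℝ) ≤ ε ^ 3 / 2 * (A.card * B.card)) :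
    regularPair E ε A B := by
  intro A' hA' B' hB' hcA hcB
  have hA0 : (0 : ℝ) < A.card := by exact_mod_cast hA.card_pos
  have hB0 : (0 : ℝ) < B.card := by exact_mod_cast hB.card_pos
  have hA'0 : A'.Nonempty := by
    rw [← card_pos]; exact_mod_cast (mul_pos hε0 hA0).trans_le hcA
  have hB'0 : B'.Nonempty := by
    rw [← card_pos]; exact_mod_cast (mul_pos hε0 hB0).trans_le hcB
  have h1 := dens_or_compl_mem_Icc E b hA hB (t := ε / 2) (h.trans (by
    gcongr
    exact pow_le_of_le_one hε0.le hε1 (by norm_num)))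
  have h2 := dens_or_compl_mem_Icc E b hA'0 hB'0 (t := ε / 2) (by
    calc (((A' ×ˢ B').filter fun p => E p.1 p.2 ≠ b).card : ℝ)
        ≤ ((A ×ˢ B).filter fun p => E p.1 p.2 ≠ b).card := by
          exact_mod_cast card_le_card (filter_subset_filter _ (product_subset_product hA' hB'))
      _ ≤ _ := h
      _ = ε / 2 * ((ε * A.card) * (ε * B.card)) := by ring
      _ ≤ _ := by gcongr)
  rw [abs_lt]
  cases b <;> simp at h1 h2 <;> constructor <;> linarith [h1.1, h1.2, h2.1, h2.2]

/-- Double counting over the blocks of a pair of partitions. -/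
theorem sum_card_filter_product_parts {X Y : Type*} [Fintype X] [Fintype Y] [DecidableEq X]
    [DecidableEq Y] (P : Finpartition (univ : Finset X)) (Q : Finpartition (univ : Finset Y))
    (D : X → Y → Prop) [∀ x y, Decidable (D x y)] :
    ∑ A ∈ P.parts, ∑ B ∈ Q.parts, ((A ×ˢ B).filter fun p => D p.1 p.2).card =
      ∑ x, (univ.filter (D x)).card := by
  have hB : ∀ A : Finset X, ∑ B ∈ Q.parts, ((A ×ˢ B).filter fun p => D p.1 p.2).card =
      ∑ x ∈ A, (univ.filter (D x)).card := by
    intro A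
    simp only [card_filter, sum_product]
    rw [sum_comm]
    refine sum_congr rfl fun x _ => ?_
    have h := sum_biUnion (f := fun y => if D x y then 1 else 0) Q.supIndep.pairwiseDisjoint
    rw [Q.biUnion_parts] at h
    exact h.symm
  simp only [hB]
  have h := sum_biUnion (f := fun x => (univ.filter (D x)).card) P.supIndep.pairwiseDisjoint
  rw [P.biUnion_parts] at h
  exact h.symm

theorem packing_rpow_bound {d : ℕ} {r m : ℝ} (hd : 2 ≤ d) (hr : 2 ≤ r) (hm0 : 0 ≤ m)
    (hm : m ≤ (4 * d / (1 / (4 * r ^ 4)) + 2) ^ (2 * d)) :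
    (m + 1) ^ d ≤ ((d : ℝ) * r ^ 3 * Real.log r) ^ ((d : ℝ) ^ (2000 * r ^ 7)) := by
  have hd2 : (2 : ℝ) ≤ d := by exact_mod_cast hd
  have hlog : 1 / 2 ≤ Real.log r := by
    have := Real.log_two_gt_d9
    have := Real.log_le_log (by norm_num) hr
    linarith
  set b := (d : ℝ) * r ^ 3 * Real.log r with hb
  have hr2 : (4 : ℝ) ≤ r ^ 2 := by nlinarith
  have hb1 : d * r ^ 3 / 2 ≤ b := by
    rw [hb, div_eq_mul_one_div]; gcongr
  have hr3 : (8 : ℝ) ≤ r ^ 3 := by nlinarith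
  have hb8 : 8 ≤ b := by nlinarith
  have hbK : 4 * d / (1 / (4 * r ^ 4)) + 2 ≤ b ^ 4 := by
    have h1 : (d * r ^ 3 / 2) ^ 2 ≤ b ^ 2 := by gcongr
    have h2 : 2 * (d * r ^ 4) ≤ (d * r ^ 3 / 2) ^ 2 := by
      have h3 : 8 ≤ d * r ^ 2 := by nlinarith
      have h4 : (d * r ^ 3 / 2) ^ 2 = (d * r ^ 4) * (d * r ^ 2) / 4 := by ring
      have h5 : 0 ≤ d * r ^ 4 := by positivity
      rw [h4]; nlinarith
    have h6 : 4 * d / (1 / (4 * r ^ 4)) = 16 * (d * r ^ 4) := by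
      rw [div_div_eq_mul_div]; ring
    have h7 : 64 ≤ b ^ 2 := by nlinarith
    rw [h6]
    nlinarith
  have hK : m + 1 ≤ b ^ (8 * d + 1) := by
    have h1 : m ≤ b ^ (8 * d) := by
      calc m ≤ _ := hm
        _ ≤ (b ^ 4) ^ (2 * d) := by gcongr
        _ = _ := by rw [← pow_mul]; congr 1; ring
    have h2 : 1 ≤ b ^ (8 * d) := one_le_pow₀ (by linarith)
    rw [pow_succ]
    nlinarith
  calc (m + 1) ^ d ≤ (b ^ (8 * d + 1)) ^ d := by gcongr
    _ = b ^ (((8 * d + 1) * d : ℕ) : ℝ) := by rw [← pow_mul, Real.rpow_natCast]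
    _ ≤ b ^ ((d : ℝ) ^ (2000 * r ^ 7)) := by
      refine Real.rpow_le_rpow_of_exponent_le (by linarith) ?_
      calc (((8 * d + 1) * d : ℕ) : ℝ) ≤ (d : ℝ) ^ 7 := by
            have : 1 ≤ d := by omega
            have h4 : 2 ^ 4 ≤ d ^ 4 := Nat.pow_le_pow_left hd 4
            have h5 : 8 * d + 1 ≤ 16 * d ^ 2 := by nlinarith
            have : (8 * d + 1) * d ≤ d ^ 7 := by
              calc (8 * d + 1) * d ≤ (d ^ 4 * d ^ 2) * d := by
                    gcongr; exact h5.trans (by gcongr; exact h4)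
                _ = d ^ 7 := by ring
            exact_mod_cast this
        _ = (d : ℝ) ^ (7 : ℝ) := by norm_cast
        _ ≤ _ := by
          refine Real.rpow_le_rpow_of_exponent_le (by linarith) ?_
          have : (1 : ℝ) ≤ r ^ 7 := one_le_pow₀ (by linarith)
          linarith

open scoped Classical in
/-- Rows can be assigned to nearby centers chosen from a set which is `δ`-separated. -/
theorem exists_separated_centers {X Y : Type*} [Fintype X] [Fintype Y] (E : X → Y → Bool)
    {δ : ℝ} (hδ : 0 ≤ δ) :
    ∃ (R : Finset X) (f : X → X), (∀ x, f x ∈ R) ∧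
      (∀ x, ((univ.filter fun y => E x y ≠ E (f x) y).card : ℝ) ≤ δ * Fintype.card Y) ∧
      ∀ x ∈ R, ∀ x' ∈ R, x ≠ x' →
        δ * Fintype.card Y ≤ (univ.filter fun y => E x y ≠ E x' y).card := by
  let sep : Finset X → Prop := fun R => ∀ x ∈ R, ∀ x' ∈ R, x ≠ x' →
    δ * Fintype.card Y ≤ (univ.filter fun y => E x y ≠ E x' y).card
  obtain ⟨R, hR, hmax⟩ := exists_max_image (univ.filter sep) card ⟨∅, by simp [sep]⟩
  have hsep : sep R := (mem_filter.1 hR).2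
  have key : ∀ x, ∃ c ∈ R,
      ((univ.filter fun y => E x y ≠ E c y).card : ℝ) ≤ δ * Fintype.card Y := by
    intro x
    by_cases hx : x ∈ R
    · exact ⟨x, hx, by simp; positivity⟩
    by_contra! hcon
    have hins : sep (insert x R) := by
      intro a ha a' ha' hne
      rcases mem_insert.1 ha with rfl | haR <;> rcases mem_insert.1 ha' with rfl | haR'
      · exact absurd rfl hne
      · exact (hcon a' haR').le
      · simpa only [ne_comm] using (hcon a haR).le
      · exact hsep a haR a' haR' hne
    have := hmax _ (mem_filter.2 ⟨mem_univ _, hins⟩)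
    rw [card_insert_of_notMem hx] at this
    omega
  choose f hfR hf using key
  exact ⟨R, f, hfR, hf, hsep⟩

open scoped Classical in
/-- Regularity lemma with bounded VC dimension: if `E` has VC dimension at most `d ≥ 2`,
then for every `r ≥ 2` there is a `1/r`-regular partition pair with at most
`C (d r³ log r)^(d^(2000 r⁷))` parts, for an absolute constant `C`. -/
theorem regularity_bounded_vc : ∃ C : ℝ, 0 < C ∧
    ∀ (X Y : Type) [Fintype X] [Fintype Y] [DecidableEq X] [DecidableEq Y]
      [Nonempty X] [Nonempty Y] (E : X → Y → Bool) (d : ℕ) (r : ℝ),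
      2 ≤ d → 2 ≤ r →
      (∀ I : Finset Y, (∀ J ⊆ I, ∃ x : X, I.filter (fun y => E x y) = J) → I.card ≤ d) →
      (∀ I : Finset X, (∀ J ⊆ I, ∃ y : Y, I.filter (fun x => E x y) = J) → I.card ≤ d) →
      ∃ (P : Finpartition (univ : Finset X)) (Q : Finpartition (univ : Finset Y)),
        (∑ Xi ∈ P.parts, ∑ Yj ∈ Q.parts,
          if ¬ regularPair E (1 / r) Xi Yj then
            ((Xi.card : ℝ) / Fintype.card X) * ((Yj.card : ℝ) / Fintype.card Y) else 0)
          < 1 / r ∧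
        (max P.parts.card Q.parts.card : ℝ) ≤
          C * ((d : ℝ) * r ^ 3 * Real.log r) ^ ((d : ℝ) ^ (2000 * r ^ 7)) := by
  refine ⟨1, one_pos, fun X Y _ _ _ _ _ _ E d r hd hr hVCY hVCX => ?_⟩
  have hr0 : 0 < r := by linarith
  set δ : ℝ := 1 / (4 * r ^ 4) with hδ
  have hδ0 : 0 < δ := by positivity
  have hδ1 : δ ≤ 1 := by
    rw [hδ, div_le_one (by positivity)]
    linarith [one_le_pow₀ (n := 4) (by linarith : (1 : ℝ) ≤ r)]
  obtain ⟨R, f, hfR, hf, hsep⟩ := exists_separated_centers E hδ0.le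
  have hRcard : (R.card : ℝ) ≤ (4 * d / δ + 2) ^ (2 * d) :=
    card_le_of_pairwise_separated E (by omega) (fun I hI => hVCY I fun J hJ => by
      obtain ⟨x, hx⟩ := hI J hJ
      exact ⟨x, by simpa using hx⟩) hδ0 hδ1 R (by simpa using hsep)
  have hbound := packing_rpow_bound hd hr (Nat.cast_nonneg R.card) hRcard
  set g : Y → Finset X := fun y => R.filter fun x => E x y with hg
  have hgcard : (univ.image g).card ≤ (R.card + 1) ^ d := by
    refine card_le_succ_card_pow_of_shatters (by simp [hg]) fun I hIR hI => hVCX I fun J hJ => ?_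
    obtain ⟨u, hu, huJ⟩ := hI hJ
    obtain ⟨y, -, rfl⟩ := mem_image.1 hu
    refine ⟨y, ?_⟩
    rw [← huJ]
    ext x
    simp only [hg, mem_filter, mem_inter]
    exact ⟨fun h => ⟨h.1, hIR h.1, h.2⟩, fun h => ⟨h.1, h.2.2⟩⟩
  have hX0 : (0 : ℝ) < Fintype.card X := by exact_mod_cast Fintype.card_pos
  have hY0 : (0 : ℝ) < Fintype.card Y := by exact_mod_cast Fintype.card_pos
  refine ⟨fiberPartition f, fiberPartition g, ?_, ?_⟩
  · have hblock : ∀ A ∈ (fiberPartition f).parts, ∀ B ∈ (fiberPartition g).parts,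
        (if ¬ regularPair E (1 / r) A B then
          ((A.card : ℝ) / Fintype.card X) * ((B.card : ℝ) / Fintype.card Y) else 0) ≤
        2 * r ^ 3 / (Fintype.card X * Fintype.card Y) *
          (((A ×ˢ B).filter fun p => E p.1 p.2 ≠ E (f p.1) p.2).card : ℝ) := by
      intro A hA B hB
      obtain ⟨a, ha⟩ := (fiberPartition f).nonempty_of_mem_parts hA
      obtain ⟨b, hb⟩ := (fiberPartition g).nonempty_of_mem_parts hB
      have hconst : ((A ×ˢ B).filter fun p => E p.1 p.2 ≠ E (f p.1) p.2) =
          (A ×ˢ B).filter fun p => E p.1 p.2 ≠ E (f a) b := by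
        refine filter_congr fun p hp => ?_
        rw [mem_product] at hp
        have h1 := eq_of_mem_parts_fiberPartition hA hp.1 ha
        have h2 := eq_of_mem_parts_fiberPartition hB hp.2 hb
        have h3 : E (f a) p.2 = E (f a) b := by
          have := Finset.ext_iff.1 h2 (f a)
          simp only [hg, mem_filter, hfR a, true_and] at this
          exact Bool.eq_iff_iff.2 this
        rw [h1, h3]
      by_cases hreg : regularPair E (1 / r) A B
      · rw [if_neg (not_not.2 hreg)]
        positivity
      · rw [if_pos hreg]
        have hlt : (1 / r) ^ 3 / 2 * ((A.card : ℝ) * B.card) <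
            ((A ×ˢ B).filter fun p => E p.1 p.2 ≠ E (f a) b).card := by
          by_contra! hle
          refine hreg (regularPair_of_card_ne_le E (E (f a) b) ⟨a, ha⟩ ⟨b, hb⟩ (by positivity) ?_ hle)
          rw [div_le_one hr0]; linarith
        rw [hconst]
        calc ((A.card : ℝ) / Fintype.card X) * ((B.card : ℝ) / Fintype.card Y)
            = 2 * r ^ 3 / (Fintype.card X * Fintype.card Y) *
              ((1 / r) ^ 3 / 2 * ((A.card : ℝ) * B.card)) := by field_simp
          _ ≤ _ := by gcongr
    have hsum := sum_card_filter_product_parts (fiberPartition f) (fiberPartition g)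
      fun x y => E x y ≠ E (f x) y
    calc _ ≤ ∑ A ∈ (fiberPartition f).parts, ∑ B ∈ (fiberPartition g).parts,
          2 * r ^ 3 / (Fintype.card X * Fintype.card Y) *
            (((A ×ˢ B).filter fun p => E p.1 p.2 ≠ E (f p.1) p.2).card : ℝ) :=
          sum_le_sum fun A hA => sum_le_sum fun B hB => hblock A hA B hB
      _ = 2 * r ^ 3 / (Fintype.card X * Fintype.card Y) *
          ∑ x, ((univ.filter fun y => E x y ≠ E (f x) y).card : ℝ) := by
          simp only [← mul_sum]
          congr 1
          exact_mod_cast hsum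
      _ ≤ 2 * r ^ 3 / (Fintype.card X * Fintype.card Y) * ∑ _x : X, δ * Fintype.card Y := by
          gcongr with x
          convert hf x
      _ = 1 / 2 * (1 / r) := by
          rw [sum_const, card_univ, nsmul_eq_mul, hδ]
          field_simp
          norm_num
      _ < 1 / r := by
          have : 0 < 1 / r := by positivity
          linarith
  · rw [one_mul]
    refine (max_le ?_ ?_).trans hbound
    · have h1 : ((fiberPartition f).parts.card : ℝ) ≤ R.card := by
        exact_mod_cast card_parts_fiberPartition_le hfR
      calc _ ≤ (R.card : ℝ) + 1 := by linarith
        _ ≤ _ := le_self_pow₀ (by linarith [Nat.cast_nonneg (α := ℝ) R.card]) (by omega)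
    · have := card_parts_fiberPartition_le (f := g) (s := univ.image g)
        (fun y => mem_image_of_mem g (mem_univ y))
      exact_mod_cast this.trans hgcard
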